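/- For every real critical exponent α > 1 there exists an infinitely renormalizable unimodal map: there exists a unimodal map f with critical exponent α and a sequence of unimodal maps (f_n)_{n≥0} with critical exponent α such that f_0 = f and, for every n, f_n is period-doubling renormalizable (with fixed point p_n ∈ (0,1), f_n(0) ≥ p_n, f_n(f_n(0)) ≥ -p_n) and f_{n+1}(x) = -f_n(f_n(-p_n·x))/p_n for all x ∈ [-1,1]. -/

import Mathlib

/-- The canonical folding map with critical exponent `α` and peak-value `t`:
`q_t(x) = -2t|x|^α + 2t - 1` (here `^` is the real power). -/
noncomputable def foldMap (α t x : ℝ) : ℝ := -2 * t * |x| ^ α + 2 * t - 1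

/-- `IsDiffeo φ d1 d2` : `φ` is an orientation-preserving C² diffeomorphism of `[-1,1]`
onto itself fixing the endpoints, with first derivative `d1 > 0` and continuous second
derivative `d2`. -/
def IsDiffeo (φ d1 d2 : ℝ → ℝ) : Prop :=
  Set.BijOn φ (Set.Icc (-1 : ℝ) 1) (Set.Icc (-1 : ℝ) 1) ∧
  φ (-1) = -1 ∧ φ 1 = 1 ∧
  (∀ x ∈ Set.Icc (-1 : ℝ) 1, HasDerivWithinAt φ (d1 x) (Set.Icc (-1 : ℝ) 1) x) ∧
  (∀ x ∈ Set.Icc (-1 : ℝ) 1, HasDerivWithinAt d1 (d2 x) (Set.Icc (-1 : ℝ) 1) x) ∧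
  ContinuousOn d2 (Set.Icc (-1 : ℝ) 1) ∧
  (∀ x ∈ Set.Icc (-1 : ℝ) 1, 0 < d1 x)

/-- `f` is a unimodal map with critical exponent `α`: `f = φ ∘ q_t` with `φ` an
orientation-preserving C² diffeomorphism of `[-1,1]` fixing the endpoints and
`t ∈ [0,1]` a peak-value. -/
def IsUnimodal (α : ℝ) (f : ℝ → ℝ) : Prop :=
  ∃ φ d1 d2 : ℝ → ℝ, ∃ t ∈ Set.Icc (0 : ℝ) 1,
    IsDiffeo φ d1 d2 ∧ ∀ x, f x = φ (foldMap α t x)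

open Set Filter Topology

lemma rpow_lipschitz_unit {α x y : ℝ} (hα : 1 ≤ α) (hx : x ∈ Icc (0 : ℝ) 1)
    (hy : y ∈ Icc (0 : ℝ) 1) : |x ^ α - y ^ α| ≤ α * |x - y| := by
  refine Convex.norm_image_sub_le_of_norm_hasDerivWithin_le (f := fun z : ℝ => z ^ α)
    (f' := fun z => α * z ^ (α - 1)) (s := Icc (0 : ℝ) 1) (fun z _ => ?_) (fun z hz => ?_)
    (convex_Icc 0 1) hy hx
  · exact (Real.hasDerivAt_rpow_const (Or.inr hα)).hasDerivWithinAt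
  · have h1 : z ^ (α - 1) ≤ 1 := Real.rpow_le_one hz.1 hz.2 (by linarith)
    have h0 : 0 ≤ z ^ (α - 1) := Real.rpow_nonneg hz.1 _
    rw [Real.norm_eq_abs, abs_of_nonneg (by positivity)]
    nlinarith

lemma foldMap_of_nonneg {α t x : ℝ} (hx : 0 ≤ x) :
    foldMap α t x = 2 * t - 1 - 2 * t * x ^ α := by
  rw [foldMap, abs_of_nonneg hx]; ring

lemma foldMap_neg (α t x : ℝ) : foldMap α t (-x) = foldMap α t x := by
  simp [foldMap]

lemma foldMap_zero {α : ℝ} (hα : 1 < α) (t : ℝ) : foldMap α t 0 = 2 * t - 1 := by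
  simp [foldMap, Real.zero_rpow (by linarith : α ≠ 0)]

lemma foldMap_one (α t : ℝ) : foldMap α t 1 = -1 := by
  simp [foldMap]

lemma foldMap_mem {α t x : ℝ} (hα : 1 < α) (ht : t ∈ Icc (0 : ℝ) 1)
    (hx : x ∈ Icc (-1 : ℝ) 1) : foldMap α t x ∈ Icc (-1 : ℝ) 1 := by
  have h0 : 0 ≤ |x| ^ α := by positivity
  have h1 : |x| ^ α ≤ 1 := Real.rpow_le_one (abs_nonneg x) (abs_le.2 hx) (by linarith)
  rw [foldMap]
  constructor <;> nlinarith [ht.1, ht.2, mul_nonneg ht.1 h0, mul_nonneg ht.1 (sub_nonneg.2 h1)]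

lemma strictMonoOn_unit_of_hasDerivWithinAt_pos {φ d1 : ℝ → ℝ}
    (h : ∀ x ∈ Icc (-1 : ℝ) 1, HasDerivWithinAt φ (d1 x) (Icc (-1 : ℝ) 1) x)
    (hpos : ∀ x ∈ Icc (-1 : ℝ) 1, 0 < d1 x) : StrictMonoOn φ (Icc (-1 : ℝ) 1) :=
  strictMonoOn_of_hasDerivWithinAt_pos (convex_Icc _ _)
    (fun x hx => (h x hx).continuousWithinAt)
    (fun x hx => (h x (interior_subset hx)).mono interior_subset)
    (fun x hx => hpos x (interior_subset hx))

namespace IsDiffeo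

variable {φ d1 d2 : ℝ → ℝ}

lemma strictMonoOn (h : IsDiffeo φ d1 d2) : StrictMonoOn φ (Icc (-1 : ℝ) 1) :=
  strictMonoOn_unit_of_hasDerivWithinAt_pos h.2.2.2.1 h.2.2.2.2.2.2

lemma continuousOn (h : IsDiffeo φ d1 d2) : ContinuousOn φ (Icc (-1 : ℝ) 1) :=
  fun x hx => (h.2.2.2.1 x hx).continuousWithinAt

lemma contDiffOn (h : IsDiffeo φ d1 d2) : ContDiffOn ℝ 2 φ (Icc (-1 : ℝ) 1) := by
  obtain ⟨-, -, -, h1, h2, hc, -⟩ := h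
  have hU : UniqueDiffOn ℝ (Icc (-1 : ℝ) 1) := uniqueDiffOn_Icc (by norm_num)
  rw [show (2 : WithTop ℕ∞) = 1 + 1 by norm_num, contDiffOn_succ_iff_derivWithin hU]
  refine ⟨fun x hx => (h1 x hx).differentiableWithinAt, by simp, ?_⟩
  refine ContDiffOn.congr (f := d1) ?_ (fun x hx => (h1 x hx).derivWithin (hU x hx))
  rw [show (1 : WithTop ℕ∞) = 0 + 1 by norm_num, contDiffOn_succ_iff_derivWithin hU]
  refine ⟨fun x hx => (h2 x hx).differentiableWithinAt, by simp, ?_⟩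
  rw [contDiffOn_zero]
  exact hc.congr (fun x hx => (h2 x hx).derivWithin (hU x hx))

lemma of_contDiffOn (h : ContDiffOn ℝ 2 φ (Icc (-1 : ℝ) 1)) (hl : φ (-1) = -1) (hr : φ 1 = 1)
    (h1 : ∀ x ∈ Icc (-1 : ℝ) 1, HasDerivWithinAt φ (d1 x) (Icc (-1 : ℝ) 1) x)
    (hpos : ∀ x ∈ Icc (-1 : ℝ) 1, 0 < d1 x) :
    IsDiffeo φ d1 (derivWithin d1 (Icc (-1 : ℝ) 1)) := by
  have hU : UniqueDiffOn ℝ (Icc (-1 : ℝ) 1) := uniqueDiffOn_Icc (by norm_num)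
  have hmono := strictMonoOn_unit_of_hasDerivWithinAt_pos h1 hpos
  rw [show (2 : WithTop ℕ∞) = 1 + 1 by norm_num, contDiffOn_succ_iff_derivWithin hU] at h
  have hd1 : ContDiffOn ℝ 1 d1 (Icc (-1 : ℝ) 1) :=
    h.2.2.congr (fun x hx => ((h1 x hx).derivWithin (hU x hx)).symm)
  have hml : (-1 : ℝ) ∈ Icc (-1 : ℝ) 1 := by norm_num
  have hmr : (1 : ℝ) ∈ Icc (-1 : ℝ) 1 := by norm_num
  refine ⟨⟨fun x hx => ?_, hmono.injOn, ?_⟩, hl, hr, h1, fun x hx => ?_, ?_, hpos⟩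
  · have e1 := hmono.monotoneOn hml hx hx.1
    have e2 := hmono.monotoneOn hx hmr hx.2
    exact ⟨hl ▸ e1, hr ▸ e2⟩
  · have := intermediate_value_Icc (by norm_num : (-1 : ℝ) ≤ 1) h.1.continuousOn
    rwa [hl, hr] at this
  · exact (hd1.differentiableOn (by norm_num) x hx).hasDerivWithinAt
  · exact hd1.continuousOn_derivWithin hU le_rfl

end IsDiffeo

namespace IsUnimodal

variable {α : ℝ} {f : ℝ → ℝ}

lemma even (hf : IsUnimodal α f) (x : ℝ) : f (-x) = f x := by
  obtain ⟨φ, d1, d2, t, ht, hφ, hf⟩ := hf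
  rw [hf, hf, foldMap_neg]

lemma apply_one (hf : IsUnimodal α f) : f 1 = -1 := by
  obtain ⟨φ, d1, d2, t, ht, hφ, hf⟩ := hf
  rw [hf, foldMap_one, hφ.2.1]

lemma mapsTo (hα : 1 < α) (hf : IsUnimodal α f) : MapsTo f (Icc (-1) 1) (Icc (-1) 1) := by
  obtain ⟨φ, d1, d2, t, ht, hφ, hf⟩ := hf
  intro x hx
  rw [hf]
  exact hφ.1.mapsTo (foldMap_mem hα ht hx)

lemma continuousOn (hα : 1 < α) (hf : IsUnimodal α f) : ContinuousOn f (Icc (-1) 1) := by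
  obtain ⟨φ, d1, d2, t, ht, hφ, hf⟩ := hf
  obtain rfl : f = φ ∘ foldMap α t := funext hf
  refine hφ.continuousOn.comp (Continuous.continuousOn ?_) (fun x hx => foldMap_mem hα ht hx)
  unfold foldMap
  have : Continuous fun x : ℝ => |x| ^ α :=
    continuous_abs.rpow_const (fun x => Or.inr (by linarith))
  fun_prop

lemma strictAntiOn (hα : 1 < α) (hf : IsUnimodal α f) (h0 : -1 < f 0) :
    StrictAntiOn f (Icc 0 1) := by
  obtain ⟨φ, d1, d2, t, ht, hφ, hf⟩ := hf
  have ht0 : 0 < t := by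
    refine lt_of_le_of_ne ht.1 ?_
    rintro rfl
    rw [hf, foldMap_zero hα] at h0
    norm_num [hφ.2.1] at h0
  intro x hx y hy hxy
  rw [hf, hf]
  refine hφ.strictMonoOn (foldMap_mem hα ht ⟨by linarith [hy.1], hy.2⟩)
    (foldMap_mem hα ht ⟨by linarith [hx.1], hx.2⟩) ?_
  rw [foldMap_of_nonneg hx.1, foldMap_of_nonneg hy.1]
  have := Real.rpow_lt_rpow hx.1 hxy (by linarith : 0 < α)
  nlinarith

lemma exists_fixed (hα : 1 < α) (hf : IsUnimodal α f) (h0 : 0 < f 0) :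
    ∃ p ∈ Ioo (0 : ℝ) 1, f p = p := by
  have hc : ContinuousOn (fun x => f x - x) (Icc 0 1) :=
    ((hf.continuousOn hα).mono (Icc_subset_Icc (by norm_num) le_rfl)).sub continuousOn_id
  obtain ⟨p, hp, hp'⟩ := intermediate_value_Ioo' (by norm_num : (0 : ℝ) ≤ 1) hc
    (show (0 : ℝ) ∈ Ioo (f 1 - 1) (f 0 - 0) by
      rw [hf.apply_one]; exact ⟨by norm_num, by linarith⟩)
  exact ⟨p, hp, by simpa [sub_eq_zero] using hp'⟩

lemma exists_renormalization (hα : 1 < α) (hf : IsUnimodal α f) {p : ℝ}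
    (hp : p ∈ Ioo (0 : ℝ) 1) (hfp : f p = p) (h0 : p ≤ f 0) (h1 : -p ≤ f (f 0)) :
    ∃ g, IsUnimodal α g ∧ ∀ x ∈ Icc (-1 : ℝ) 1, g x = -(f (f (-p * x))) / p := by
  obtain ⟨hp0, hp1⟩ := hp
  have hanti := hf.strictAntiOn hα (by linarith)
  have hcont := (hf.continuousOn hα).mono
    (Icc_subset_Icc (by linarith) le_rfl : Icc p 1 ⊆ Icc (-1) 1)
  have hf1 := hf.apply_one
  obtain ⟨q, ⟨hpq, hq1⟩, hfq⟩ := intermediate_value_Ioo' hp1.le hcont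
    (show -p ∈ Ioo (f 1) (f p) by rw [hf1, hfp]; constructor <;> linarith)
  have hf0 := hf.mapsTo hα (show (0 : ℝ) ∈ Icc (-1 : ℝ) 1 by norm_num)
  have hcq : f 0 ≤ q := by
    by_contra! h
    have := hanti ⟨by linarith, hq1.le⟩ ⟨by linarith, hf0.2⟩ h
    linarith
  obtain ⟨φ, d1, d2, t, ht, hφ, hfφ⟩ := hf
  have ht0 : 0 < t := by
    refine lt_of_le_of_ne ht.1 ?_
    rintro rfl
    have := hfφ p
    norm_num [foldMap, hφ.2.1, hfp] at this
    linarith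
  have hmono := hφ.strictMonoOn
  obtain ⟨B, hB, hφB⟩ := hφ.1.surjOn (show q ∈ Icc (-1 : ℝ) 1 from ⟨by linarith, hq1.le⟩)
  set A := foldMap α t p with hAdef
  have hA : A ∈ Icc (-1 : ℝ) 1 := foldMap_mem hα ht ⟨by linarith, hp1.le⟩
  have hφA : φ A = p := by rw [← hfφ, hfp]
  have hAB : A < B := (hmono.lt_iff_lt hA hB).1 (by rw [hφA, hφB]; exact hpq)
  have htB : 2 * t - 1 ≤ B := by
    refine (hmono.le_iff_le ?_ hB).1 ?_
    · exact ⟨by linarith, by linarith [ht.2]⟩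
    · rw [hφB, ← foldMap_zero hα t, ← hfφ]; exact hcq
  set L : ℝ → ℝ := fun z => A + (z + 1) * ((B - A) / 2) with hL
  have hLmem : MapsTo L (Icc (-1) 1) (Icc A B) := by
    intro z hz
    constructor <;> simp only [hL] <;> nlinarith [hz.1, hz.2]
  have hABI : Icc A B ⊆ Icc (-1) 1 := Icc_subset_Icc hA.1 hB.2
  have hφL : ∀ z ∈ Icc (-1 : ℝ) 1, φ (L z) ∈ Icc p q := fun z hz =>
    ⟨hφA ▸ hmono.monotoneOn hA (hABI (hLmem hz)) (hLmem hz).1,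
      hφB ▸ hmono.monotoneOn (hABI (hLmem hz)) hB (hLmem hz).2⟩
  set Q : ℝ → ℝ := fun y => 2 * t - 1 - 2 * t * y ^ α with hQ
  have hQf : ∀ y, 0 ≤ y → Q y = foldMap α t y := fun y hy => (foldMap_of_nonneg hy).symm
  have hQmem : ∀ y ∈ Icc p q, Q y ∈ Icc (-1 : ℝ) 1 := fun y hy => by
    rw [hQf y (by linarith [hy.1])]
    exact foldMap_mem hα ht ⟨by linarith [hy.1], by linarith [hy.2]⟩
  have hfQ : ∀ y, 0 ≤ y → φ (Q y) = f y := fun y hy => by rw [hfφ, hQf y hy]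
  set ψ : ℝ → ℝ := fun z => -φ (Q (φ (L z))) / p with hψ
  have hLd : ∀ z, HasDerivAt L ((B - A) / 2) z := fun z =>
    ((((hasDerivAt_id z).add_const 1).mul_const ((B - A) / 2)).const_add A).congr_deriv
      (one_mul _)
  have hQd : ∀ y, 0 < y → HasDerivAt Q (-(2 * t * (α * y ^ (α - 1)))) y := fun y hy => by
    simpa using ((Real.hasDerivAt_rpow_const (x := y) (p := α) (Or.inl hy.ne')).const_mul
      (2 * t)).const_sub (2 * t - 1)
  have hφLd : ∀ z ∈ Icc (-1 : ℝ) 1,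
      HasDerivWithinAt (φ ∘ L) (d1 (L z) * ((B - A) / 2)) (Icc (-1) 1) z := fun z hz =>
    (hφ.2.2.2.1 _ (hABI (hLmem hz))).comp z (hLd z).hasDerivWithinAt
      (fun w hw => hABI (hLmem hw))
  have hψd : ∀ z ∈ Icc (-1 : ℝ) 1, HasDerivWithinAt ψ
      (-(d1 (Q (φ (L z))) * (-(2 * t * (α * (φ (L z)) ^ (α - 1))) *
        (d1 (L z) * ((B - A) / 2)))) / p) (Icc (-1) 1) z := fun z hz =>
    ((HasDerivWithinAt.comp (h₂ := φ) (h := Q ∘ (φ ∘ L)) z (hφ.2.2.2.1 _ (hQmem _ (hφL z hz)))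
      (HasDerivAt.comp_hasDerivWithinAt z (hQd (φ (L z)) (by linarith [(hφL z hz).1])) (hφLd z hz))
      (fun w hw => hQmem _ (hφL w hw))).neg).div_const p
  have hψc : ContDiffOn ℝ 2 ψ (Icc (-1) 1) := by
    have e1 : ContDiffOn ℝ 2 (φ ∘ L) (Icc (-1) 1) := by
      refine hφ.contDiffOn.comp (ContDiff.contDiffOn ?_) (fun w hw => hABI (hLmem hw))
      fun_prop
    have e2 : ContDiffOn ℝ 2 (fun z => Q ((φ ∘ L) z)) (Icc (-1) 1) := by
      refine contDiffOn_const.sub (contDiffOn_const.mul (e1.rpow_const_of_ne fun z hz => ?_))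
      have := (hφL z hz).1
      exact ne_of_gt (by simp only [Function.comp]; linarith)
    exact ((hφ.contDiffOn.comp e2 (fun w hw => hQmem _ (hφL w hw))).neg).div_const p
  have hψl : ψ (-1) = -1 := by
    have : L (-1) = A := by simp [hL]
    simp only [hψ]
    rw [this, hφA, hfQ p hp0.le, hfp, neg_div, div_self hp0.ne']
  have hψr : ψ 1 = 1 := by
    have : L 1 = B := by simp only [hL]; ring
    simp only [hψ]
    rw [this, hφB, hfQ q (by linarith), hfq, neg_neg, div_self hp0.ne']
  set s := 2 * t * p ^ α / (B - A) with hs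
  have hAeq : A = 2 * t - 1 - 2 * t * p ^ α := foldMap_of_nonneg hp0.le
  have hBA : 0 < B - A := sub_pos.2 hAB
  have hLs : ∀ x, L (foldMap α s x) = foldMap α t (-p * x) := fun x => by
    have : s * (B - A) = 2 * t * p ^ α := div_mul_cancel₀ _ hBA.ne'
    simp only [hL, foldMap]
    rw [abs_mul, abs_neg, abs_of_pos hp0, Real.mul_rpow hp0.le (abs_nonneg x)]
    linear_combination (1 - |x| ^ α) * this + hAeq
  refine ⟨fun x => ψ (foldMap α s x), ⟨ψ, _, _, s, ⟨by positivity, ?_⟩,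
    IsDiffeo.of_contDiffOn hψc hψl hψr hψd ?_, fun _ => rfl⟩, fun x hx => ?_⟩
  · rw [hs, div_le_one hBA]; linarith
  · intro z hz
    have hy : 0 < φ (L z) := by linarith [(hφL z hz).1]
    have a1 := hφ.2.2.2.2.2.2 _ (hABI (hLmem hz))
    have a2 := hφ.2.2.2.2.2.2 _ (hQmem _ (hφL z hz))
    have a3 : 0 < φ (L z) ^ (α - 1) := Real.rpow_pos_of_pos hy _
    have a4 : 0 < α := by linarith
    refine div_pos ?_ hp0
    rw [neg_mul, mul_neg, neg_neg]
    positivity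
  · have hmem : f (-p * x) ∈ Ici (0 : ℝ) := by
      have e : f (-p * x) = f (p * |x|) := by
        rw [hfφ, hfφ]; congr 1; simp [foldMap, abs_mul]
      have hx1 : |x| ≤ 1 := abs_le.2 hx
      have := hanti.antitoneOn (a := p * |x|) (b := p) ⟨by positivity, by nlinarith⟩
        ⟨hp0.le, hp1.le⟩ (by nlinarith)
      rw [mem_Ici, e]; linarith
    simp only [hψ]
    rw [hLs, ← hfφ, hfQ _ hmem]

end IsUnimodal

lemma exists_last_zero_before_first_one {h : ℝ → ℝ} {u v : ℝ} (huv : u ≤ v)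
    (hc : ContinuousOn h (Icc u v)) (hu : h u ≤ 0) (hv : 1 ≤ h v) :
    ∃ a b, u ≤ a ∧ a < b ∧ b ≤ v ∧ h a = 0 ∧ h b = 1 ∧ (∀ t ∈ Ioc a b, 0 < h t) ∧
      ∀ t ∈ Icc a b, h t ≤ 1 := by
  have compact_level : ∀ w ≤ v, ∀ c, IsCompact (Icc u w ∩ h ⁻¹' {c}) := fun w hw c =>
    isCompact_Icc.of_isClosed_subset ((hc.mono (Icc_subset_Icc le_rfl hw)).preimage_isClosed_of_isClosed
      isClosed_Icc isClosed_singleton) inter_subset_left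
  obtain ⟨b, ⟨⟨hub, hbv⟩, hb : h b = 1⟩, hbmin⟩ := (compact_level v le_rfl 1).exists_isLeast
    (by obtain ⟨b, hb, hb'⟩ := intermediate_value_Icc huv hc ⟨by linarith, hv⟩
        exact ⟨b, hb, hb'⟩)
  have hcb := hc.mono (Icc_subset_Icc le_rfl hbv)
  obtain ⟨a, ⟨⟨hua, hab⟩, ha : h a = 0⟩, hamax⟩ := (compact_level b hbv 0).exists_isGreatest
    (by obtain ⟨a, ha, ha'⟩ := intermediate_value_Icc hub hcb ⟨hu, by linarith⟩
        exact ⟨a, ha, ha'⟩)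
  refine ⟨a, b, hua, lt_of_le_of_ne hab ?_, hbv, ha, hb, fun t ht => ?_, fun t ht => ?_⟩
  · rintro rfl; linarith
  · by_contra! hneg
    obtain ⟨s, hs, hs'⟩ := intermediate_value_Icc ht.2
      (hcb.mono (Icc_subset_Icc (hua.trans ht.1.le) le_rfl)) ⟨hneg, by linarith⟩
    have := hamax ⟨⟨hua.trans (ht.1.le.trans hs.1), hs.2⟩, hs'⟩
    linarith [ht.1, hs.1]
  · by_contra! hgt
    obtain ⟨s, hs, hs'⟩ := intermediate_value_Icc ht.1
      (hcb.mono (Icc_subset_Icc hua ht.2)) (show (1 : ℝ) ∈ Icc (h a) (h t) from ⟨by linarith, hgt.le⟩)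
    have hbs := hbmin ⟨⟨hua.trans hs.1, hs.2.trans (ht.2.trans hbv)⟩, hs'⟩
    obtain rfl : t = b := le_antisymm ht.2 (hbs.trans hs.2)
    linarith

/-- A continuous family of unimodal maps over `[a, b]` whose critical value runs from `0` to `1`
and is positive on `(a, b]`, with uniform control of the maps by `|x| ^ α`. -/
structure IsFullFamily (α a b : ℝ) (f : ℝ → ℝ → ℝ) : Prop where
  lt : a < b
  unimodal : ∀ t ∈ Icc a b, IsUnimodal α (f t)
  continuousOn : ContinuousOn (fun z : ℝ × ℝ => f z.1 z.2) (Icc a b ×ˢ Icc (-1) 1)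
  left : f a 0 = 0
  right : f b 0 = 1
  pos : ∀ t ∈ Ioc a b, 0 < f t 0
  lipschitz : ∃ K, 0 ≤ K ∧ ∀ t ∈ Icc a b, ∀ x ∈ Icc (-1 : ℝ) 1, ∀ y ∈ Icc (-1 : ℝ) 1,
    |f t x - f t y| ≤ K * |(|x| ^ α - |y| ^ α)|

/-- `p` is a fixed point witnessing that `f` is period-doubling renormalizable, and `g` is the
corresponding renormalization of `f` on `[-1, 1]`. -/
def RenormalizesTo (f g : ℝ → ℝ) (p : ℝ) : Prop :=
  p ∈ Ioo (0 : ℝ) 1 ∧ f p = p ∧ p ≤ f 0 ∧ -p ≤ f (f 0) ∧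
    ∀ x ∈ Icc (-1 : ℝ) 1, g x = -(f (f (-p * x))) / p

lemma isFullFamily_foldMap {α : ℝ} (hα : 1 < α) : IsFullFamily α (1 / 2) 1 (foldMap α) where
  lt := by norm_num
  unimodal t ht := by
    refine ⟨id, fun _ => 1, fun _ => 0, t, ⟨by linarith [ht.1], ht.2⟩, ⟨bijOn_id _, rfl, rfl,
      fun x _ => hasDerivWithinAt_id _ _, fun x _ => hasDerivWithinAt_const _ _ _,
      continuousOn_const, fun _ _ => one_pos⟩, fun _ => rfl⟩
  continuousOn := by
    refine Continuous.continuousOn ?_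
    unfold foldMap
    have : Continuous fun z : ℝ × ℝ => |z.2| ^ α :=
      continuous_snd.abs.rpow_const (fun z => Or.inr (by linarith))
    fun_prop
  left := by rw [foldMap_zero hα]; norm_num
  right := by rw [foldMap_zero hα]; norm_num
  pos t ht := by rw [foldMap_zero hα]; linarith [ht.1]
  lipschitz := by
    refine ⟨2, by norm_num, fun t ht x _ y _ => ?_⟩
    have : foldMap α t x - foldMap α t y = -(2 * t) * (|x| ^ α - |y| ^ α) := by
      simp only [foldMap]; ring
    rw [this, abs_mul, abs_neg, abs_of_nonneg (by linarith [ht.1])]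
    exact mul_le_mul_of_nonneg_right (by linarith [ht.2]) (abs_nonneg _)

namespace IsFullFamily

variable {α a b : ℝ} {f : ℝ → ℝ → ℝ}

lemma continuousOn_comp (hf : IsFullFamily α a b f) {X : Type*} [TopologicalSpace X] {s : Set X}
    {u v : X → ℝ} (hu : ContinuousOn u s) (hv : ContinuousOn v s) (hus : MapsTo u s (Icc a b))
    (hvs : MapsTo v s (Icc (-1) 1)) : ContinuousOn (fun x => f (u x) (v x)) s :=
  hf.continuousOn.comp (hu.prodMk hv) fun _ hx => ⟨hus hx, hvs hx⟩

lemma continuousOn_apply (hf : IsFullFamily α a b f) {x : ℝ} (hx : x ∈ Icc (-1 : ℝ) 1) :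
    ContinuousOn (fun t => f t x) (Icc a b) :=
  hf.continuousOn_comp continuousOn_id continuousOn_const (fun _ h => h) (fun _ _ => hx)

lemma strictAntiOn (hα : 1 < α) (hf : IsFullFamily α a b f) {t : ℝ} (ht : t ∈ Ioc a b) :
    StrictAntiOn (f t) (Icc 0 1) :=
  (hf.unimodal t (Ioc_subset_Icc_self ht)).strictAntiOn hα (by linarith [hf.pos t ht])

lemma exists_continuousOn_fixed (hα : 1 < α) (hf : IsFullFamily α a b f) :
    ∃ p : ℝ → ℝ, (∀ t ∈ Ioc a b, p t ∈ Ioo (0 : ℝ) 1 ∧ f t (p t) = p t) ∧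
      ContinuousOn p (Ioc a b) := by
  have hex : ∀ t, ∃ p, t ∈ Ioc a b → p ∈ Ioo (0 : ℝ) 1 ∧ f t p = p := fun t => by
    by_cases ht : t ∈ Ioc a b
    · obtain ⟨p, hp⟩ :=
        (hf.unimodal t (Ioc_subset_Icc_self ht)).exists_fixed hα (hf.pos t ht)
      exact ⟨p, fun _ => hp⟩
    · exact ⟨0, fun h => absurd h ht⟩
  choose p hp using hex
  refine ⟨p, hp, fun t ht => ?_⟩
  have happ : ∀ x ∈ Ioo (0 : ℝ) 1, Tendsto (fun s => f s x) (𝓝[Ioc a b] t) (𝓝 (f t x)) :=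
    fun x hx => (hf.continuousOn_apply ⟨by linarith [hx.1], hx.2.le⟩).mono Ioc_subset_Icc_self t ht
  obtain ⟨hpt, hft⟩ := hp t ht
  have hanti := hf.strictAntiOn hα ht
  refine tendsto_order.2 ⟨fun l hl => ?_, fun r hr => ?_⟩
  · obtain ⟨x, hx1, hx2⟩ := exists_between (max_lt hl hpt.1)
    have hx : x ∈ Ioo (0 : ℝ) 1 := ⟨(le_max_right _ _).trans_lt hx1, hx2.trans hpt.2⟩
    have hlt : x < f t x := hx2.trans (hft.symm.trans_lt
      (hanti (Ioo_subset_Icc_self hx) (Ioo_subset_Icc_self hpt) hx2))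
    filter_upwards [(happ x hx).eventually_const_lt hlt, self_mem_nhdsWithin] with s hs hsI
    obtain ⟨hps, hfs⟩ := hp s hsI
    refine ((le_max_left _ _).trans_lt hx1).trans ?_
    by_contra! hle
    have := (hf.strictAntiOn hα hsI).antitoneOn (Ioo_subset_Icc_self hps)
      (Ioo_subset_Icc_self hx) hle
    linarith
  · obtain ⟨x, hx1, hx2⟩ := exists_between (lt_min hr hpt.2)
    have hx : x ∈ Ioo (0 : ℝ) 1 := ⟨hpt.1.trans hx1, hx2.trans_le (min_le_right _ _)⟩
    have hlt : f t x < x := (hanti (Ioo_subset_Icc_self hpt) (Ioo_subset_Icc_self hx) hx1).trans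
      (hft.trans_lt hx1)
    filter_upwards [(happ x hx).eventually_lt_const hlt, self_mem_nhdsWithin] with s hs hsI
    obtain ⟨hps, hfs⟩ := hp s hsI
    refine lt_of_lt_of_le ?_ (hx2.le.trans (min_le_left _ _))
    by_contra! hle
    have := (hf.strictAntiOn hα hsI).antitoneOn (Ioo_subset_Icc_self hx)
      (Ioo_subset_Icc_self hps) hle
    linarith

lemma exists_critical_orbit_nonneg (hα : 1 < α) (hf : IsFullFamily α a b f) :
    ∃ t ∈ Ioo a b, 0 ≤ f t (f t 0) := by
  obtain ⟨K, hK, hlip⟩ := hf.lipschitz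
  have hab := hf.lt
  have hz : (0 : ℝ) ∈ Icc (-1 : ℝ) 1 := by norm_num
  have hlim : Tendsto (fun t => f t 0) (𝓝[>] a) (𝓝 0) := by
    have := (hf.continuousOn_apply hz a ⟨le_rfl, hab.le⟩).tendsto
    rw [hf.left, nhdsWithin_Icc_eq_nhdsGE hab] at this
    exact this.mono_left (nhdsWithin_mono _ Ioi_subset_Ici_self)
  have hlim' : Tendsto (fun t => K * f t 0 ^ (α - 1)) (𝓝[>] a) (𝓝 0) := by
    have := (hlim.rpow_const (p := α - 1) (Or.inr (by linarith))).const_mul K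
    rwa [Real.zero_rpow (by linarith), mul_zero] at this
  obtain ⟨t, ht1, ht⟩ := ((hlim'.eventually_lt_const one_pos).and
    (Ioo_mem_nhdsGT hab)).exists
  refine ⟨t, ht, ?_⟩
  have htI : t ∈ Icc a b := Ioo_subset_Icc_self ht
  have hc := hf.pos t (Ioo_subset_Ioc_self ht)
  have h := hlip t htI 0 hz _ ((hf.unimodal t htI).mapsTo hα hz)
  rw [abs_zero, Real.zero_rpow (by linarith), zero_sub, abs_neg, abs_of_pos hc,
    abs_of_nonneg (Real.rpow_nonneg hc.le _)] at h
  have hpow : f t 0 ^ α = f t 0 ^ (α - 1) * f t 0 := by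
    rw [← Real.rpow_add_one hc.ne']; ring_nf
  rw [hpow] at h
  have := (abs_le.1 h).2
  nlinarith

lemma exists_renormalization (hα : 1 < α) (hf : IsFullFamily α a b f) :
    ∃ a' b' g, IsFullFamily α a' b' g ∧ a < a' ∧ b' ≤ b ∧
      ∀ t ∈ Icc a' b', ∃ p, RenormalizesTo (f t) (g t) p := by
  obtain ⟨p, hp, hpc⟩ := hf.exists_continuousOn_fixed hα
  obtain ⟨u, hu, hu0⟩ := hf.exists_critical_orbit_nonneg hα
  have hz : (0 : ℝ) ∈ Icc (-1 : ℝ) 1 := by norm_num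
  have hsub : Icc u b ⊆ Ioc a b := fun t ht => ⟨hu.1.trans_le ht.1, ht.2⟩
  have hsub' : Icc u b ⊆ Icc a b := hsub.trans Ioc_subset_Icc_self
  have hmaps : ∀ t ∈ Icc u b, MapsTo (f t) (Icc (-1) 1) (Icc (-1) 1) := fun t ht =>
    (hf.unimodal t (hsub' ht)).mapsTo hα
  have hcrit : ContinuousOn (fun t => -(f t (f t 0)) / p t) (Icc u b) := by
    refine ContinuousOn.div (ContinuousOn.neg ?_) (hpc.mono hsub)
      (fun t ht => (hp t (hsub ht)).1.1.ne')
    exact hf.continuousOn_comp continuousOn_id ((hf.continuousOn_apply hz).mono hsub')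
      (fun t ht => hsub' ht) (fun t ht => hmaps t ht hz)
  obtain ⟨a', b', hua, hab, hbb, ha, hb, hpos, hle⟩ := exists_last_zero_before_first_one
    hu.2.le hcrit
    (div_nonpos_of_nonpos_of_nonneg (neg_nonpos.2 hu0) (hp u ⟨hu.1, hu.2.le⟩).1.1.le)
    (by
      have hbI : b ∈ Icc u b := ⟨hu.2.le, le_rfl⟩
      have hpb := (hp b (hsub hbI)).1
      rw [hf.right, (hf.unimodal b (hsub' hbI)).apply_one, neg_neg, one_le_div hpb.1]
      exact hpb.2.le)
  have hI : Icc a' b' ⊆ Icc u b := Icc_subset_Icc hua hbb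
  have hfix : ∀ t ∈ Icc a' b', p t ≤ f t 0 := fun t ht => by
    obtain ⟨hpt, hft⟩ := hp t (hsub (hI ht))
    exact hft.symm.trans_le ((hf.strictAntiOn hα (hsub (hI ht))).antitoneOn
      ⟨le_rfl, zero_le_one⟩ (Ioo_subset_Icc_self hpt) hpt.1.le)
  have hcrit_ge : ∀ t ∈ Icc a' b', -p t ≤ f t (f t 0) := fun t ht => by
    have := (div_le_one (hp t (hsub (hI ht))).1.1).1 (hle t ht)
    linarith
  have hex : ∀ t, ∃ g, t ∈ Icc a' b' → IsUnimodal α g ∧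
      ∀ x ∈ Icc (-1 : ℝ) 1, g x = -(f t (f t (-p t * x))) / p t := fun t => by
    by_cases ht : t ∈ Icc a' b'
    · obtain ⟨hpt, hft⟩ := hp t (hsub (hI ht))
      obtain ⟨g, hg⟩ := (hf.unimodal t (hsub' (hI ht))).exists_renormalization hα hpt hft
        (hfix t ht) (hcrit_ge t ht)
      exact ⟨g, fun _ => hg⟩
    · exact ⟨0, fun h => absurd h ht⟩
  choose g hg using hex
  have hg0 : ∀ t ∈ Icc a' b', g t 0 = -(f t (f t 0)) / p t := fun t ht => by
    rw [(hg t ht).2 0 hz, mul_zero]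
  have hscale : ∀ t ∈ Icc a' b', ∀ x ∈ Icc (-1 : ℝ) 1, -p t * x ∈ Icc (-1 : ℝ) 1 := by
    intro t ht x hx
    obtain ⟨⟨h0, h1⟩, -⟩ := hp t (hsub (hI ht))
    constructor <;> nlinarith [hx.1, hx.2]
  refine ⟨a', b', g, ⟨hab, fun t ht => (hg t ht).1, ?_, ?_, ?_, fun t ht => ?_, ?_⟩,
    hu.1.trans_le hua, hbb, fun t ht => ⟨p t, (hp t (hsub (hI ht))).1, (hp t (hsub (hI ht))).2,
      hfix t ht, hcrit_ge t ht, (hg t ht).2⟩⟩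
  · have hfst : ContinuousOn (fun z : ℝ × ℝ => z.1) (Icc a' b' ×ˢ Icc (-1) 1) :=
      continuous_fst.continuousOn
    have hp' : ContinuousOn (fun z : ℝ × ℝ => p z.1) (Icc a' b' ×ˢ Icc (-1) 1) :=
      hpc.comp hfst fun z hz => hsub (hI hz.1)
    have h1 : ContinuousOn (fun z : ℝ × ℝ => f z.1 (-p z.1 * z.2))
        (Icc a' b' ×ˢ Icc (-1) 1) :=
      hf.continuousOn_comp hfst (hp'.neg.mul continuous_snd.continuousOn)
        (fun z hz => hsub' (hI hz.1)) (fun z hz => hscale _ hz.1 _ hz.2)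
    have h2 := hf.continuousOn_comp hfst h1 (fun z hz => hsub' (hI hz.1))
      (fun z hz => hmaps _ (hI hz.1) (hscale _ hz.1 _ hz.2))
    exact (h2.neg.div hp' fun z hz => (hp _ (hsub (hI hz.1))).1.1.ne').congr
      fun z hz => (hg _ hz.1).2 _ hz.2
  · rw [hg0 a' ⟨le_rfl, hab.le⟩, ha]
  · rw [hg0 b' ⟨hab.le, le_rfl⟩, hb]
  · rw [hg0 t (Ioc_subset_Icc_self ht)]
    exact hpos t ht
  · obtain ⟨K, hK, hlip⟩ := hf.lipschitz
    refine ⟨α * K ^ 2, by positivity, fun t ht x hx y hy => ?_⟩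
    obtain ⟨⟨hp0, hp1⟩, hft⟩ := hp t (hsub (hI ht))
    have htI := hsub' (hI ht)
    have hinner : ∀ x ∈ Icc (-1 : ℝ) 1, f t (-p t * x) ∈ Icc (0 : ℝ) 1 := fun x hx => by
      refine ⟨?_, (hmaps t (hI ht) (hscale t ht x hx)).2⟩
      have hx1 : |x| ≤ 1 := abs_le.2 hx
      have hev : f t (-p t * x) = f t (p t * |x|) := by
        rcases abs_choice x with h | h <;> rw [h]
        · rw [neg_mul, (hf.unimodal t htI).even]
        · rw [neg_mul, mul_neg]
      have := (hf.strictAntiOn hα (hsub (hI ht))).antitoneOn (a := p t * |x|) (b := p t)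
        ⟨by positivity, by nlinarith⟩ ⟨hp0.le, hp1.le⟩ (by nlinarith)
      rw [hev]; linarith
    have hpow : ∀ x : ℝ, |-p t * x| ^ α = p t ^ α * |x| ^ α := fun x => by
      rw [abs_mul, abs_neg, abs_of_pos hp0, Real.mul_rpow hp0.le (abs_nonneg x)]
    have hpα : p t ^ α ≤ p t := by
      simpa using Real.rpow_le_rpow_of_exponent_ge hp0 hp1.le hα.le
    set X := f t (-p t * x)
    set Y := f t (-p t * y)
    have hX := hinner x hx
    have hY := hinner y hy
    have e1 : |X - Y| ≤ K * (p t * |(|x| ^ α - |y| ^ α)|) := by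
      refine (hlip t htI _ (hscale t ht x hx) _ (hscale t ht y hy)).trans ?_
      rw [hpow, hpow, ← mul_sub, abs_mul, abs_of_pos (Real.rpow_pos_of_pos hp0 _)]
      gcongr
    have e2 : |f t X - f t Y| ≤ K * (α * |X - Y|) := by
      refine (hlip t htI X ⟨by linarith [hX.1], hX.2⟩ Y ⟨by linarith [hY.1], hY.2⟩).trans ?_
      rw [abs_of_nonneg hX.1, abs_of_nonneg hY.1]
      exact mul_le_mul_of_nonneg_left (rpow_lipschitz_unit hα.le hX hY) hK
    rw [(hg t ht).2 x hx, (hg t ht).2 y hy, ← sub_div, abs_div, abs_of_pos hp0, div_le_iff₀ hp0,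
      neg_sub_neg, abs_sub_comm]
    calc |f t X - f t Y| ≤ K * (α * |X - Y|) := e2
      _ ≤ K * (α * (K * (p t * |(|x| ^ α - |y| ^ α)|))) := by gcongr
      _ = α * K ^ 2 * |(|x| ^ α - |y| ^ α)| * p t := by ring

end IsFullFamily

/-- For every critical exponent `α > 1` there exists an infinitely renormalizable unimodal
map: a unimodal map `f` together with a sequence of unimodal maps `(f_n)` with `f_0 = f`
such that each `f_n` is period-doubling renormalizable (with fixed point `p_n ∈ (0,1)`,
`f_n 0 ≥ p_n`, `f_n (f_n 0) ≥ -p_n`) and `f_{n+1}` is the renormalization of `f_n`: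
`f_{n+1}(x) = -f_n(f_n(-p_n·x))/p_n` on `[-1,1]`. -/
theorem exists_infinitely_renormalizable (α : ℝ) (hα : 1 < α) :
    ∃ f : ℝ → ℝ, ∃ fseq : ℕ → ℝ → ℝ, ∃ p : ℕ → ℝ,
      fseq 0 = f ∧
      ∀ n : ℕ,
        IsUnimodal α (fseq n) ∧
        p n ∈ Set.Ioo (0 : ℝ) 1 ∧
        fseq n (p n) = p n ∧
        p n ≤ fseq n 0 ∧
        -(p n) ≤ fseq n (fseq n 0) ∧
        ∀ x ∈ Set.Icc (-1 : ℝ) 1,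
          fseq (n + 1) x = -(fseq n (fseq n (-(p n) * x))) / p n := by
  let Family := {F : ℝ × ℝ × (ℝ → ℝ → ℝ) // IsFullFamily α F.1 F.2.1 F.2.2}
  have hstep : ∀ F : Family, ∃ G : Family, F.1.1 < G.1.1 ∧ G.1.2.1 ≤ F.1.2.1 ∧
      ∀ t ∈ Icc G.1.1 G.1.2.1, ∃ p, RenormalizesTo (F.1.2.2 t) (G.1.2.2 t) p := fun F => by
    obtain ⟨a, b, g, hg, h⟩ := F.2.exists_renormalization hα
    exact ⟨⟨(a, b, g), hg⟩, h⟩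
  choose step hlt hle hren using hstep
  let F : ℕ → Family := fun n => step^[n] ⟨(1 / 2, 1, foldMap α), isFullFamily_foldMap hα⟩
  have hF : ∀ n, F (n + 1) = step (F n) := fun n => Function.iterate_succ_apply' _ _ _
  have hmono : Monotone fun n => (F n).1.1 := monotone_nat_of_le_succ fun n => by
    rw [hF]; exact (hlt _).le
  have hanti : Antitone fun n => (F n).1.2.1 := antitone_nat_of_succ_le fun n => by
    rw [hF]; exact hle _
  obtain ⟨t, ht⟩ : ∃ t, ∀ n, t ∈ Icc (F n).1.1 (F n).1.2.1 :=
    ⟨_, fun n => mem_iInter.1 (hmono.ciSup_mem_iInter_Icc_of_antitone hanti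
      fun n => (F n).2.lt.le) n⟩
  have hex : ∀ n, ∃ p, RenormalizesTo ((F n).1.2.2 t) ((F (n + 1)).1.2.2 t) p := fun n => by
    have := ht (n + 1)
    rw [hF] at this ⊢
    exact hren _ t this
  choose p hp using hex
  exact ⟨_, fun n => (F n).1.2.2 t, p, rfl, fun n => ⟨(F n).2.unimodal t (ht n), hp n⟩⟩
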